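/- arXiv:1207.6453 — 2 statements merged into one kernel-verified Lean document; each statement's English description precedes it below -/
import Mathlib

section
/- The first derivative of d at t = 5 is strictly positive: d'(5) > 0, where d'(5) = ∫₀^{1/2} G_−(x)⁵ log G_−(x) dx − ∫₀^{1/2} G_+(x)⁵ log G_+(x) dx. -/
open MeasureTheory

/-- `G₊(x) = |1 + e(x) + e(7x)|² = 3 + 2(cos 2πx + cos 12πx + cos 14πx)`. -/
noncomputable def Gp (x : ℝ) : ℝ :=
  3 + 2 * (Real.cos (2 * Real.pi * x) + Real.cos (12 * Real.pi * x) + Real.cos (14 * Real.pi * x))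

/-- `G₋(x) = |1 + e(x) − e(7x)|² = 3 + 2(cos 2πx − cos 12πx − cos 14πx)`. -/
noncomputable def Gm (x : ℝ) : ℝ :=
  3 + 2 * (Real.cos (2 * Real.pi * x) - Real.cos (12 * Real.pi * x) - Real.cos (14 * Real.pi * x))

/-- `d(t) = ∫₀^{1/2} (G₋ᵗ − G₊ᵗ)`, real powers (`0^t = 0` for `t ≠ 0`). -/
noncomputable def d (t : ℝ) : ℝ := ∫ x in (0:ℝ)..(1/2), (Gm x ^ t - Gp x ^ t)

open Real Set

/-! ### Derivative of `t ↦ ∫ G ^ t` -/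

lemma hasDerivAt_const_rpow_of_nonneg {y t : ℝ} (hy : 0 ≤ y) (ht : 0 < t) :
    HasDerivAt (fun s : ℝ => y ^ s) (y ^ t * log y) t := by
  rcases hy.eq_or_lt with rfl | hy
  · rw [log_zero, mul_zero]
    refine (hasDerivAt_const t (0 : ℝ)).congr_of_eventuallyEq ?_
    filter_upwards [lt_mem_nhds ht] with s hs
    exact zero_rpow hs.ne'
  · exact (hasStrictDerivAt_const_rpow hy t).hasDerivAt

lemma abs_rpow_mul_log_le {y t : ℝ} (hy : 0 ≤ y) (hy9 : y ≤ 9) (ht : 1 ≤ t) (ht6 : t ≤ 6) :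
    |y ^ t * log y| ≤ 9 ^ 7 := by
  rcases hy.eq_or_lt with rfl | hy
  · simp
  rw [abs_mul, abs_of_nonneg (rpow_nonneg hy.le t)]
  rcases le_total y 1 with h1 | h1
  · have h2 : y ^ t ≤ y := by simpa using rpow_le_rpow_of_exponent_ge hy h1 ht
    have h3 := abs_log_mul_self_lt y hy h1
    rw [abs_mul, abs_of_pos hy] at h3
    nlinarith [abs_nonneg (log y)]
  · have h2 : y ^ t ≤ y ^ 6 := by
      rw [← rpow_natCast]
      exact rpow_le_rpow_of_exponent_le h1 (by exact_mod_cast ht6)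
    have h3 : |log y| ≤ 9 := by
      rw [abs_of_nonneg (log_nonneg h1)]
      linarith [log_le_sub_one_of_pos hy]
    calc y ^ t * |log y| ≤ 9 ^ 6 * 9 := by
          gcongr
          exact h2.trans (by gcongr)
      _ = 9 ^ 7 := by norm_num

lemma hasDerivAt_integral_rpow {G : ℝ → ℝ} (hG : Continuous G) (h0 : ∀ x, 0 ≤ G x)
    (h9 : ∀ x, G x ≤ 9) (a b : ℝ) :
    HasDerivAt (fun t : ℝ => ∫ x in a..b, G x ^ t) (∫ x in a..b, G x ^ (5 : ℝ) * log (G x)) 5 := by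
  refine (intervalIntegral.hasDerivAt_integral_of_dominated_loc_of_deriv_le
    (F := fun t x => G x ^ t) (F' := fun t x => G x ^ t * log (G x))
    (bound := fun _ => 9 ^ 7) (Metric.ball_mem_nhds (5 : ℝ) one_pos) ?_ ?_ ?_ ?_ ?_ ?_).2
  · filter_upwards with t
    exact (hG.measurable.pow_const t).aestronglyMeasurable
  · exact (hG.rpow_const fun _ => Or.inr (by norm_num)).intervalIntegrable _ _
  · exact ((hG.measurable.pow_const 5).mul (measurable_log.comp hG.measurable)).aestronglyMeasurable
  · filter_upwards with x _ t ht
    rw [Metric.mem_ball, dist_eq, abs_lt] at ht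
    exact abs_rpow_mul_log_le (h0 x) (h9 x) (by linarith) (by linarith)
  · exact intervalIntegrable_const
  · filter_upwards with x _ t ht
    rw [Metric.mem_ball, dist_eq, abs_lt] at ht
    exact hasDerivAt_const_rpow_of_nonneg (h0 x) (by linarith)

/-! ### Polynomial approximation of `y ^ 5 * log y` on `[0, 9]` -/

/-- Coefficients of the polynomial `q` with `q(0) = 0` and
`y q'(y) = 1 - (1 - 4y/9 + 16y²/405) ^ 10`. -/
noncomputable def logCoeff : Fin 21 → ℝ :=
  ![0, 40/9, -376/81, 2944/729, -30272/10935, 741376/492075, -2920448/4428675, 2424832/10333575,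
    -40902656/597871125, 7157055488/435848050125, -177144856576/54481006265625,
    10410262528/19613162255625, -20942159872/294197433834375, 9932111872/1274855546615625,
    -191394480128/278016574973484375, 777389080576/16085244694894453125,
    -126969970688/48255734084683359375, 790273982464/7383127314956553984375,
    -1614907703296/527676452216012534765625, 549755813888/10025852592104238160546875,
    -274877906944/593636008743014101611328125]

/-- A polynomial which approximates `log` up to a constant on `(0, 9]`. -/
noncomputable def logPoly (y : ℝ) : ℝ := ∑ i, logCoeff i * y ^ (i : ℕ)

lemma hasDerivAt_logPoly {y : ℝ} (hy : y ≠ 0) :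
    HasDerivAt logPoly ((1 - (1 - 4 * y / 9 + 16 * y ^ 2 / 405) ^ 10) / y) y := by
  have h : HasDerivAt logPoly (∑ i : Fin 21, logCoeff i * ((i : ℕ) * y ^ ((i : ℕ) - 1))) y := by
    unfold logPoly
    exact HasDerivAt.fun_sum fun i _ => (hasDerivAt_pow (i : ℕ) y).const_mul _
  convert h using 1
  rw [div_eq_iff hy]
  simp [Fin.sum_univ_succ, logCoeff]
  ring

lemma hasDerivAt_log_sub_logPoly {y : ℝ} (hy : y ≠ 0) :
    HasDerivAt (fun y => log y - logPoly y) ((1 - 4 * y / 9 + 16 * y ^ 2 / 405) ^ 10 / y) y := by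
  refine ((hasDerivAt_log hy).sub (hasDerivAt_logPoly hy)).congr_deriv ?_
  field_simp
  ring

lemma log_sub_logPoly_le {y : ℝ} (hy : 0 < y) (hy9 : y ≤ 9) :
    log y - logPoly y ≤ log 9 - logPoly 9 := by
  have hmono : MonotoneOn (fun y => log y - logPoly y) (Ioi 0) := by
    refine monotoneOn_of_deriv_nonneg (convex_Ioi 0)
      (fun z hz => (hasDerivAt_log_sub_logPoly (ne_of_gt hz)).continuousAt.continuousWithinAt)
      (fun z hz => ?_) (fun z hz => ?_)
    all_goals rw [interior_Ioi] at hz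
    · exact (hasDerivAt_log_sub_logPoly (ne_of_gt hz)).differentiableAt.differentiableWithinAt
    · rw [(hasDerivAt_log_sub_logPoly (ne_of_gt hz)).deriv]
      exact div_nonneg (by positivity) (le_of_lt hz)
  exact hmono hy (show (0 : ℝ) < 9 by norm_num) hy9

lemma mul_sq_chebyshev_le {y : ℝ} (hy9 : y ≤ 9) :
    y * (1 - 4 * y / 9 + 16 * y ^ 2 / 405) ^ 2 ≤ 9 / 25 := by
  set x := 1 - 2 * y / 9 with hx
  have h : 9 / 25 - y * (1 - 4 * y / 9 + 16 * y ^ 2 / 405) ^ 2 =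
      (1 + x) * (4 * x ^ 2 - 2 * x - 1) ^ 2 * (9 / 50) := by
    rw [hx]; ring
  have : 0 ≤ 1 + x := by rw [hx]; linarith
  have : 0 ≤ (1 + x) * (4 * x ^ 2 - 2 * x - 1) ^ 2 * (9 / 50) := by positivity
  linarith

lemma le_log_sub_logPoly {y : ℝ} (hy : 0 < y) (hy9 : y ≤ 9) :
    log 9 - logPoly 9 ≤ log y - logPoly y + (9 / 25) ^ 5 / 5 / y ^ 5 := by
  have hd : ∀ z : ℝ, z ≠ 0 → HasDerivAt (fun y => log y - logPoly y + (9 / 25) ^ 5 / 5 / y ^ 5)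
      (((z * (1 - 4 * z / 9 + 16 * z ^ 2 / 405) ^ 2) ^ 5 - (9 / 25) ^ 5) / z ^ 6) z := by
    intro z hz
    refine ((hasDerivAt_log_sub_logPoly hz).add ((hasDerivAt_const z ((9 / 25 : ℝ) ^ 5 / 5)).div
      (hasDerivAt_pow 5 z) (pow_ne_zero 5 hz))).congr_deriv ?_
    generalize 1 - 4 * z / 9 + 16 * z ^ 2 / 405 = u
    push_cast
    field_simp
    ring
  have hanti : AntitoneOn (fun y => log y - logPoly y + (9 / 25) ^ 5 / 5 / y ^ 5) (Ioc 0 9) := by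
    refine antitoneOn_of_deriv_nonpos (convex_Ioc 0 9)
      (fun z hz => (hd z (ne_of_gt hz.1)).continuousAt.continuousWithinAt)
      (fun z hz => ?_) (fun z hz => ?_)
    all_goals replace hz := interior_subset hz
    · exact (hd z (ne_of_gt hz.1)).differentiableAt.differentiableWithinAt
    · rw [(hd z (ne_of_gt hz.1)).deriv]
      have hz0 := hz.1
      refine div_nonpos_of_nonpos_of_nonneg (sub_nonpos.2 ?_) (by positivity)
      exact pow_le_pow_left₀ (by positivity) (mul_sq_chebyshev_le hz.2) 5
  have h := hanti ⟨hy, hy9⟩ (show (9 : ℝ) ∈ Ioc 0 9 by norm_num) hy9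
  have : (0 : ℝ) ≤ (9 / 25) ^ 5 / 5 / 9 ^ 5 := by positivity
  simp only at h
  linarith

lemma pow_mul_log_le {y : ℝ} (hy : 0 ≤ y) (hy9 : y ≤ 9) :
    y ^ 5 * log y ≤ y ^ 5 * (logPoly y + (log 9 - logPoly 9)) := by
  rcases hy.eq_or_lt with rfl | hy
  · simp
  · gcongr
    linarith [log_sub_logPoly_le hy hy9]

lemma le_pow_mul_log {y : ℝ} (hy : 0 ≤ y) (hy9 : y ≤ 9) :
    y ^ 5 * (logPoly y + (log 9 - logPoly 9)) - (9 / 25) ^ 5 / 5 ≤ y ^ 5 * log y := by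
  rcases hy.eq_or_lt with rfl | hy
  · norm_num
  · have h := mul_le_mul_of_nonneg_left (le_log_sub_logPoly hy hy9) (pow_pos hy 5).le
    have h5 : y ^ 5 * ((9 / 25) ^ 5 / 5 / y ^ 5) = (9 / 25) ^ 5 / 5 := by field_simp
    rw [mul_add, h5] at h
    linarith

/-! ### Parseval's identity for polynomials given by lists of integer coefficients -/

/-- The point `e(x) = exp(2πix)` of the unit circle. -/
noncomputable def circlePoint (x : ℝ) : ℂ := Complex.exp ((2 * π * x : ℝ) * Complex.I)

lemma circlePoint_pow (x : ℝ) (n : ℕ) :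
    circlePoint x ^ n = Complex.exp ((2 * π * n * x : ℝ) * Complex.I) := by
  rw [circlePoint, ← Complex.exp_nat_mul]
  congr 1
  push_cast
  ring

@[fun_prop]
lemma continuous_circlePoint : Continuous circlePoint := by
  unfold circlePoint
  fun_prop

lemma re_circlePoint_pow (x : ℝ) (n : ℕ) : (circlePoint x ^ n).re = cos (2 * π * n * x) := by
  rw [circlePoint_pow, Complex.exp_ofReal_mul_I_re]

lemma im_circlePoint_pow (x : ℝ) (n : ℕ) : (circlePoint x ^ n).im = sin (2 * π * n * x) := by
  rw [circlePoint_pow, Complex.exp_ofReal_mul_I_im]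

lemma normSq_circlePoint (x : ℝ) : Complex.normSq (circlePoint x) = 1 := by
  rw [Complex.normSq_eq_norm_sq, circlePoint, Complex.norm_exp_ofReal_mul_I, one_pow]

lemma integral_re_circlePoint_pow_succ (n : ℕ) :
    ∫ x in (0 : ℝ)..(1 / 2), (circlePoint x ^ (n + 1)).re = 0 := by
  simp only [re_circlePoint_pow]
  have hc : 2 * π * ((n + 1 : ℕ) : ℝ) ≠ 0 := by positivity
  rw [intervalIntegral.integral_comp_mul_left (fun x => cos x) hc, integral_cos]
  have : 2 * π * ((n + 1 : ℕ) : ℝ) * (1 / 2) = ((n + 1 : ℕ) : ℝ) * π := by ring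
  rw [this, sin_nat_mul_pi]
  simp

/-- Evaluation of the polynomial with the given list of coefficients. -/
def listEval : List ℤ → ℂ → ℂ
  | [], _ => 0
  | a :: l, z => a + z * listEval l z

/-- Sum of polynomials given by their lists of coefficients. -/
def listAdd : List ℤ → List ℤ → List ℤ
  | [], m => m
  | a :: l, [] => a :: l
  | a :: l, b :: m => (a + b) :: listAdd l m

/-- Multiplication of a polynomial by `1 + X + s X ^ 7`. -/
def mulTrinomial (s : ℤ) (l : List ℤ) : List ℤ :=
  listAdd l (listAdd (0 :: l) (0 :: 0 :: 0 :: 0 :: 0 :: 0 :: 0 :: l.map (s * ·)))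

/-- The coefficients of `(1 + X + s X ^ 7) ^ k`. -/
def trinomialPow (s : ℤ) : ℕ → List ℤ
  | 0 => [1]
  | k + 1 => mulTrinomial s (trinomialPow s k)

/-- The sum of the squares of the entries of a list. -/
def sumSq : List ℤ → ℤ
  | [] => 0
  | a :: l => a * a + sumSq l

lemma listEval_listAdd (l m : List ℤ) (z : ℂ) :
    listEval (listAdd l m) z = listEval l z + listEval m z := by
  induction l generalizing m with
  | nil => simp [listAdd, listEval]
  | cons a l ih =>
    cases m with
    | nil => simp [listAdd, listEval]
    | cons b m =>
      simp only [listAdd, listEval, ih]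
      push_cast
      ring

lemma listEval_map_mul (s : ℤ) (l : List ℤ) (z : ℂ) :
    listEval (l.map (s * ·)) z = s * listEval l z := by
  induction l with
  | nil => simp [listEval]
  | cons a l ih =>
    simp only [List.map_cons, listEval, ih]
    push_cast
    ring

lemma listEval_trinomialPow (s : ℤ) (k : ℕ) (z : ℂ) :
    listEval (trinomialPow s k) z = (1 + z + s * z ^ 7) ^ k := by
  induction k with
  | zero => simp [trinomialPow, listEval]
  | succ k ih =>
    simp only [trinomialPow, mulTrinomial, listEval_listAdd, listEval, listEval_map_mul, ih]
    push_cast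
    ring

@[fun_prop]
lemma continuous_listEval (l : List ℤ) : Continuous (listEval l) := by
  induction l with
  | nil => exact continuous_const
  | cons a l ih => exact continuous_const.add (continuous_id.mul ih)

lemma integral_re_circlePoint_pow_succ_mul (l : List ℤ) (n : ℕ) :
    ∫ x in (0 : ℝ)..(1 / 2), (circlePoint x ^ (n + 1) * listEval l (circlePoint x)).re = 0 := by
  induction l generalizing n with
  | nil => simp [listEval]
  | cons a l ih =>
    have h : ∀ x, (circlePoint x ^ (n + 1) * listEval (a :: l) (circlePoint x)).re =
        a * (circlePoint x ^ (n + 1)).re +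
          (circlePoint x ^ (n + 1 + 1) * listEval l (circlePoint x)).re := by
      intro x
      have : circlePoint x ^ (n + 1) * listEval (a :: l) (circlePoint x) =
          ((a : ℝ) : ℂ) * circlePoint x ^ (n + 1) +
            circlePoint x ^ (n + 1 + 1) * listEval l (circlePoint x) := by
        simp only [listEval]
        push_cast
        ring
      rw [this, Complex.add_re, Complex.re_ofReal_mul]
    simp only [h]
    rw [intervalIntegral.integral_add, intervalIntegral.integral_const_mul, ih,
      integral_re_circlePoint_pow_succ, mul_zero, add_zero]
    all_goals exact Continuous.intervalIntegrable (by fun_prop) _ _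

lemma integral_normSq_listEval (l : List ℤ) :
    ∫ x in (0 : ℝ)..(1 / 2), Complex.normSq (listEval l (circlePoint x)) = sumSq l / 2 := by
  induction l with
  | nil => simp [listEval, sumSq]
  | cons a l ih =>
    have h : ∀ x, Complex.normSq (listEval (a :: l) (circlePoint x)) =
        (a * a + 2 * a * (circlePoint x ^ (0 + 1) * listEval l (circlePoint x)).re) +
          Complex.normSq (listEval l (circlePoint x)) := by
      intro x
      have ha : (a : ℂ) = ((a : ℝ) : ℂ) := by push_cast; rfl
      rw [listEval, Complex.normSq_add, Complex.normSq_mul, normSq_circlePoint, ha,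
        Complex.normSq_ofReal, Complex.re_ofReal_mul, Complex.conj_re, zero_add, pow_one]
      ring
    have hN : Continuous fun x => Complex.normSq (listEval l (circlePoint x)) :=
      Complex.continuous_normSq.comp (by fun_prop)
    have hR : Continuous fun x => a * a + 2 * (a : ℝ) *
        (circlePoint x ^ (0 + 1) * listEval l (circlePoint x)).re := by fun_prop
    simp only [h]
    rw [intervalIntegral.integral_add (hR.intervalIntegrable _ _)
        (hN.intervalIntegrable _ _),
      intervalIntegral.integral_add intervalIntegrable_const
        (Continuous.intervalIntegrable (by fun_prop) _ _),
      intervalIntegral.integral_const, intervalIntegral.integral_const_mul,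
      integral_re_circlePoint_pow_succ_mul, ih, sumSq]
    push_cast
    rw [smul_eq_mul]
    ring

/-! ### The functions `Gp` and `Gm` -/

lemma normSq_trinomial (s : ℤ) (hs : s ^ 2 = 1) (x : ℝ) :
    Complex.normSq (1 + circlePoint x + s * circlePoint x ^ 7) =
      3 + 2 * (cos (2 * π * x) + s * cos (12 * π * x) + s * cos (14 * π * x)) := by
  have hsR : (s : ℝ) ^ 2 = 1 := by exact_mod_cast hs
  have h1r := re_circlePoint_pow x 1
  have h1i := im_circlePoint_pow x 1
  have h7r := re_circlePoint_pow x 7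
  have h7i := im_circlePoint_pow x 7
  rw [pow_one] at h1r h1i
  have e1 : 2 * π * ((1 : ℕ) : ℝ) * x = 2 * π * x := by push_cast; ring
  have e7 : 2 * π * ((7 : ℕ) : ℝ) * x = 14 * π * x := by push_cast; ring
  rw [e1] at h1r h1i
  rw [e7] at h7r h7i
  have h6 : cos (12 * π * x) = cos (14 * π * x) * cos (2 * π * x) +
      sin (14 * π * x) * sin (2 * π * x) := by
    rw [← cos_sub]
    congr 1
    ring
  have hc : (s : ℂ) = ((s : ℝ) : ℂ) := by push_cast; rfl
  rw [Complex.normSq_apply, hc, Complex.add_re, Complex.add_im, Complex.add_re, Complex.add_im,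
    Complex.re_ofReal_mul, Complex.im_ofReal_mul, Complex.one_re, Complex.one_im, h1r, h1i, h7r,
    h7i, h6]
  linear_combination sin_sq_add_cos_sq (2 * π * x) +
    (s : ℝ) ^ 2 * sin_sq_add_cos_sq (14 * π * x) + hsR

lemma Gp_eq_normSq (x : ℝ) :
    Gp x = Complex.normSq (1 + circlePoint x + (1 : ℤ) * circlePoint x ^ 7) := by
  rw [normSq_trinomial 1 (by norm_num), Gp]
  push_cast
  ring

lemma Gm_eq_normSq (x : ℝ) :
    Gm x = Complex.normSq (1 + circlePoint x + (-1 : ℤ) * circlePoint x ^ 7) := by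
  rw [normSq_trinomial (-1) (by norm_num), Gm]
  push_cast
  ring

lemma Gp_nonneg (x : ℝ) : 0 ≤ Gp x := Gp_eq_normSq x ▸ Complex.normSq_nonneg _

lemma Gm_nonneg (x : ℝ) : 0 ≤ Gm x := Gm_eq_normSq x ▸ Complex.normSq_nonneg _

lemma Gp_le (x : ℝ) : Gp x ≤ 9 := by
  unfold Gp
  linarith [cos_le_one (2 * π * x), cos_le_one (12 * π * x), cos_le_one (14 * π * x)]

lemma Gm_le (x : ℝ) : Gm x ≤ 9 := by
  unfold Gm
  linarith [cos_le_one (2 * π * x), neg_one_le_cos (12 * π * x), neg_one_le_cos (14 * π * x)]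

@[fun_prop]
lemma continuous_Gp : Continuous Gp := by
  unfold Gp
  fun_prop

@[fun_prop]
lemma continuous_Gm : Continuous Gm := by
  unfold Gm
  fun_prop

lemma integral_Gp_pow (k : ℕ) :
    ∫ x in (0 : ℝ)..(1 / 2), Gp x ^ k = sumSq (trinomialPow 1 k) / 2 := by
  rw [← integral_normSq_listEval]
  simp only [listEval_trinomialPow, map_pow, ← Gp_eq_normSq]

lemma integral_Gm_pow (k : ℕ) :
    ∫ x in (0 : ℝ)..(1 / 2), Gm x ^ k = sumSq (trinomialPow (-1) k) / 2 := by
  rw [← integral_normSq_listEval]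
  simp only [listEval_trinomialPow, map_pow, ← Gm_eq_normSq]

/-- The differences `∫₀¹ (G₋ ^ (5 + i) - G₊ ^ (5 + i))`. -/
def momentDiff : Fin 21 → ℤ :=
  ![0, 0, -28, -1376, -36432, -708360, -11421960, -162546384, -2117225968, -25831109304,
    -299812896240, -3346740787520, -36215278521760, -382136025435840, -3949568605613904,
    -40123596136898880, -401755612965398440, -3973658070721620248, -38891824129091240736,
    -377222820243658479200, -3630213550295268811600]

lemma sumSq_trinomialPow_sub (i : Fin 21) :
    sumSq (trinomialPow (-1) (5 + i)) - sumSq (trinomialPow 1 (5 + i)) = momentDiff i := by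
  revert i
  decide +kernel

lemma integral_Gm_pow_sub_integral_Gp_pow (i : Fin 21) :
    (∫ x in (0 : ℝ)..(1 / 2), Gm x ^ (5 + (i : ℕ))) - ∫ x in (0 : ℝ)..(1 / 2), Gp x ^ (5 + (i : ℕ))
      = momentDiff i / 2 := by
  rw [integral_Gm_pow, integral_Gp_pow, ← sumSq_trinomialPow_sub]
  push_cast
  ring

lemma integral_pow_mul_logPoly {G : ℝ → ℝ} (hG : Continuous G) (c : ℝ) :
    ∫ x in (0 : ℝ)..(1 / 2), G x ^ 5 * (logPoly (G x) + c) =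
      ∑ i, logCoeff i * (∫ x in (0 : ℝ)..(1 / 2), G x ^ (5 + (i : ℕ))) +
        c * ∫ x in (0 : ℝ)..(1 / 2), G x ^ (5 + ((0 : Fin 21) : ℕ)) := by
  have h : ∀ x, G x ^ 5 * (logPoly (G x) + c) =
      ∑ i, logCoeff i * G x ^ (5 + (i : ℕ)) + c * G x ^ (5 + ((0 : Fin 21) : ℕ)) := by
    intro x
    rw [logPoly, mul_add, Finset.mul_sum, Fin.val_zero, add_zero, mul_comm c]
    congr 1
    refine Finset.sum_congr rfl fun i _ => ?_
    ring
  simp only [h]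
  rw [intervalIntegral.integral_add, intervalIntegral.integral_finsetSum]
  · simp only [intervalIntegral.integral_const_mul]
  all_goals intros; exact Continuous.intervalIntegrable (by fun_prop) _ _

lemma continuous_logPoly : Continuous logPoly := by
  unfold logPoly
  fun_prop

lemma continuous_pow_mul_log : Continuous fun y : ℝ => y ^ 5 * log y := by
  have h : (fun y : ℝ => y ^ 5 * log y) = fun y => y ^ 4 * (y * log y) := by
    funext y
    ring
  rw [h]
  exact (continuous_pow 4).mul continuous_mul_log

lemma integral_pow_mul_log_lt :
    ∫ x in (0 : ℝ)..(1 / 2), Gp x ^ 5 * log (Gp x) <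
      ∫ x in (0 : ℝ)..(1 / 2), Gm x ^ 5 * log (Gm x) := by
  set c := log 9 - logPoly 9
  have hp : ∫ x in (0 : ℝ)..(1 / 2), Gp x ^ 5 * log (Gp x) ≤
      ∫ x in (0 : ℝ)..(1 / 2), Gp x ^ 5 * (logPoly (Gp x) + c) := by
    refine intervalIntegral.integral_mono_on (by norm_num)
      ((continuous_pow_mul_log.comp continuous_Gp).intervalIntegrable _ _)
      (Continuous.intervalIntegrable ?_ _ _) fun x _ => pow_mul_log_le (Gp_nonneg x) (Gp_le x)
    exact (continuous_Gp.pow 5).mul ((continuous_logPoly.comp continuous_Gp).add continuous_const)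
  have hmc : Continuous fun x => Gm x ^ 5 * (logPoly (Gm x) + c) :=
    (continuous_Gm.pow 5).mul ((continuous_logPoly.comp continuous_Gm).add continuous_const)
  have hm : ∫ x in (0 : ℝ)..(1 / 2), (Gm x ^ 5 * (logPoly (Gm x) + c) - (9 / 25) ^ 5 / 5) ≤
      ∫ x in (0 : ℝ)..(1 / 2), Gm x ^ 5 * log (Gm x) :=
    intervalIntegral.integral_mono_on (by norm_num)
      ((hmc.sub continuous_const).intervalIntegrable _ _)
      ((continuous_pow_mul_log.comp continuous_Gm).intervalIntegrable _ _)
      fun x _ => le_pow_mul_log (Gm_nonneg x) (Gm_le x)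
  rw [intervalIntegral.integral_sub (hmc.intervalIntegrable _ _) intervalIntegrable_const,
    intervalIntegral.integral_const, smul_eq_mul, integral_pow_mul_logPoly continuous_Gm] at hm
  rw [integral_pow_mul_logPoly continuous_Gp] at hp
  have h0 := integral_Gm_pow_sub_integral_Gp_pow 0
  rw [show momentDiff 0 = 0 from rfl, Int.cast_zero, zero_div, sub_eq_zero] at h0
  have hsum : (∑ i, logCoeff i * ∫ x in (0 : ℝ)..(1 / 2), Gm x ^ (5 + (i : ℕ))) -
      ∑ i, logCoeff i * ∫ x in (0 : ℝ)..(1 / 2), Gp x ^ (5 + (i : ℕ)) =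
        ∑ i, logCoeff i * (momentDiff i / 2) := by
    simp only [← integral_Gm_pow_sub_integral_Gp_pow, mul_sub, Finset.sum_sub_distrib]
  have hpos : (1 / 2 - 0 : ℝ) * ((9 / 25) ^ 5 / 5) < ∑ i, logCoeff i * (momentDiff i / 2) := by
    simp [Fin.sum_univ_succ, logCoeff, momentDiff]
    norm_num
  rw [h0] at hm
  linarith

theorem stmt9 :
    deriv d 5 =
      (∫ x in (0:ℝ)..(1/2), Gm x ^ 5 * Real.log (Gm x)) -
      (∫ x in (0:ℝ)..(1/2), Gp x ^ 5 * Real.log (Gp x)) ∧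
    0 < deriv d 5 := by
  have h5 : ∀ y : ℝ, y ^ (5 : ℝ) = y ^ 5 := fun y => by exact_mod_cast rpow_natCast y 5
  have hd : HasDerivAt d ((∫ x in (0:ℝ)..(1/2), Gm x ^ 5 * Real.log (Gm x)) -
      (∫ x in (0:ℝ)..(1/2), Gp x ^ 5 * Real.log (Gp x))) 5 := by
    have h := (hasDerivAt_integral_rpow continuous_Gm Gm_nonneg Gm_le 0 (1 / 2)).sub
      (hasDerivAt_integral_rpow continuous_Gp Gp_nonneg Gp_le 0 (1 / 2))
    simp only [h5] at h
    refine h.congr_of_eventuallyEq ?_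
    filter_upwards [lt_mem_nhds (show (0 : ℝ) < 5 by norm_num)] with t ht
    exact intervalIntegral.integral_sub
      ((continuous_Gm.rpow_const fun _ => Or.inr ht.le).intervalIntegrable _ _)
      ((continuous_Gp.rpow_const fun _ => Or.inr ht.le).intervalIntegrable _ _)
  rw [hd.deriv]
  exact ⟨rfl, sub_pos.2 integral_pow_mul_log_lt⟩
end

section
/- The third derivative of d at t = 5 is strictly positive: d'''(5) > 0, where d'''(5) = ∫₀^{1/2} G_−(x)⁵ (log G_−(x))³ dx − ∫₀^{1/2} G_+(x)⁵ (log G_+(x))³ dx. -/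
open MeasureTheory

/-- `j`-th coefficient in `s` of the falling factorial `∏ i < k, (5 + s - i)`. -/
def fallCoeff : ℕ → ℕ → ℤ
  | 0, 0 => 1
  | _ + 1, 0 => 0
  | 0, k + 1 => (5 - k) * fallCoeff 0 k
  | j + 1, k + 1 => (5 - k) * fallCoeff (j + 1) k + fallCoeff j k

/-- Sum of polynomials given by their coefficient lists. -/
def coeffAdd : List ℤ → List ℤ → List ℤ
  | [], l => l
  | l, [] => l
  | a :: l, b :: l' => (a + b) :: coeffAdd l l'

/-- Product of polynomials given by their coefficient lists. -/
def coeffMul : List ℤ → List ℤ → List ℤ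
  | [], _ => []
  | a :: p, l => coeffAdd (l.map (a * ·)) (0 :: coeffMul p l)

/-- The coefficients of `z ^ 7 * (2 * G - 9)`, where `G = trinomialSq s` and `z = e(x)`. -/
def base (s : ℤ) : List ℤ := [2 * s, 2 * s, 0, 0, 0, 0, 2, -3, 2, 0, 0, 0, 0, 2 * s, 2 * s]

/-- The coefficients of the `k`-th power of `base s`. -/
def basePow (s : ℤ) : ℕ → List ℤ
  | 0 => [1]
  | k + 1 => coeffMul (base s) (basePow s k)

/-- The constant term of the Laurent polynomial `(2 * G - 9) ^ k`, where `G = trinomialSq s`. -/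
def moment (s : ℤ) (k : ℕ) : ℤ := (basePow s k).getD (7 * k) 0

/-- The values of `moment (-1) k - moment 1 k` for `k < 31`. -/
def momentDiffs : List ℤ :=
  [0, 0, 0, 0, 0, 0, 0, -3584, -94208, -571392, -17018880, -70118400, -2023329792,
    -7901763584, -200629997568, -844508121600, -18013247283200, -86315666837504,
    -1521405635862528, -8486292847319040, -123394860951920640, -807309633553633280,
    -9727986044089229312, -74722767147370366464, -751146604789941899264,
    -6761516389121562675200, -57088999026779173376000, -600558910938269870146560,
    -4284879985674501337313280, -52530448263258465263462400, -318305275757226570149376000]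

theorem map_moment_sub :
    (List.range 31).map (fun k => moment (-1) k - moment 1 k) = momentDiffs := by
  decide +kernel

theorem fallCoeff_zero_values :
    (List.range 31).map (fallCoeff 0) =
      [1, 5, 20, 60, 120, 120, 0, 0, 0, 0, 0, 0, 0, 0, 0, 0, 0, 0, 0, 0, 0, 0, 0, 0, 0, 0, 0, 0,
      0, 0, 0] := by
  decide +kernel

theorem fallCoeff_one_values :
    (List.range 31).map (fallCoeff 1) =
      [0, 1, 9, 47, 154, 274, 120, -120, 240, -720, 2880, -14400, 86400, -604800, 4838400,
      -43545600, 435456000, -4790016000, 57480192000, -747242496000, 10461394944000,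
      -156920924160000, 2510734786560000, -42682491371520000, 768284844687360000,
      -14597412049059840000, 291948240981196800000, -6130913060605132800000,
      134880087333312921600000, -3102242008666197196800000, 74453808207988732723200000] := by
  decide +kernel

theorem fallCoeff_two_values :
    (List.range 31).map (fallCoeff 2) =
      [0, 0, 1, 12, 71, 225, 274, -154, 188, -324, 576, 0, -14400, 187200, -2102400, 23760000,
      -281145600, 3528057600, -47126707200, 670127385600, -10129025894400, 162396783360000,
      -2755269457920000, 49350315571200000, -930988171653120000, 18457060106096640000,
      -383738614170992640000, 8350459138572042240000, -189841014109190062080000,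
      4501223411844684349440000, -111131603892938621583360000] := by
  decide +kernel

theorem fallCoeff_three_values :
    (List.range 31).map (fallCoeff 3) =
      [0, 0, 0, 1, 14, 85, 225, 49, -252, 944, -4100, 21076, -126456, 870792, -6779136, 58909824,
      -565338240, 5937575040, -67722842880, 833270250240, -10995656117760, 154805815872000,
      -2314496270592000, 36591167142144000, -609290692987392000, 10645534995107328000,
      -194453639796049920000, 3699787821546055680000, -73044872935441182720000,
      1490191063405957140480000, -31263362109898287022080000] := by
  decide +kernel

/-- The common form of `Gp` (`s = 1`) and `Gm` (`s = -1`). -/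
noncomputable def trinomialSq (s x : ℝ) : ℝ :=
  3 + 2 * (Real.cos (2 * Real.pi * x) + s * Real.cos (12 * Real.pi * x) +
    s * Real.cos (14 * Real.pi * x))

theorem Gp_eq : Gp = trinomialSq 1 := by
  ext x; simp [Gp, trinomialSq]

theorem Gm_eq : Gm = trinomialSq (-1) := by
  ext x; simp [Gm, trinomialSq]; ring

theorem continuous_trinomialSq (s : ℝ) : Continuous (trinomialSq s) := by
  unfold trinomialSq; fun_prop

theorem trinomialSq_nonneg {s : ℝ} (hs : s ^ 2 = 1) (x : ℝ) : 0 ≤ trinomialSq s x := by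
  have h : trinomialSq s x =
      (1 + Real.cos (2 * Real.pi * x) + s * Real.cos (14 * Real.pi * x)) ^ 2 +
      (Real.sin (2 * Real.pi * x) + s * Real.sin (14 * Real.pi * x)) ^ 2 := by
    have h12 : Real.cos (12 * Real.pi * x) =
        Real.cos (14 * Real.pi * x) * Real.cos (2 * Real.pi * x) +
        Real.sin (14 * Real.pi * x) * Real.sin (2 * Real.pi * x) := by
      rw [← Real.cos_sub]; ring_nf
    have h1 := Real.sin_sq_add_cos_sq (2 * Real.pi * x)
    have h2 := Real.sin_sq_add_cos_sq (14 * Real.pi * x)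
    rw [trinomialSq, h12]
    linear_combination (-1) * h1 - s ^ 2 * h2 - hs
  rw [h]; positivity

theorem trinomialSq_le {s : ℝ} (hs : s ^ 2 = 1) (x : ℝ) : trinomialSq s x ≤ 9 := by
  have h1 := Real.cos_le_one (2 * Real.pi * x)
  have h2 := Real.cos_le_one (12 * Real.pi * x)
  have h3 := Real.cos_le_one (14 * Real.pi * x)
  have h2' := Real.neg_one_le_cos (12 * Real.pi * x)
  have h3' := Real.neg_one_le_cos (14 * Real.pi * x)
  unfold trinomialSq
  rcases mul_self_eq_one_iff.mp ((sq s).symm.trans hs) with rfl | rfl <;> linarith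

/-! ### Differentiation under the integral sign -/

theorem abs_rpow_mul_log_pow_le {v t : ℝ} {j : ℕ} (hv : 0 ≤ v) (hv9 : v ≤ 9) (ht : 4 ≤ t)
    (ht6 : t ≤ 6) (hj : j ≤ 3) : |v ^ t * Real.log v ^ j| ≤ 9 ^ 9 := by
  rcases hv.eq_or_lt with rfl | hv0
  · rw [Real.zero_rpow (by linarith)]; norm_num
  have hjr : (j : ℝ) ≤ 3 := by exact_mod_cast hj
  rw [abs_mul, abs_of_nonneg (Real.rpow_nonneg hv t), abs_pow]
  rcases le_total v 1 with h1 | h1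
  · have h2 : v ^ t ≤ v ^ j := by
      rw [← Real.rpow_natCast]
      exact Real.rpow_le_rpow_of_exponent_ge hv0 h1 (by linarith)
    calc v ^ t * |Real.log v| ^ j ≤ v ^ j * |Real.log v| ^ j := by gcongr
      _ = |Real.log v * v| ^ j := by rw [abs_mul, abs_of_pos hv0]; ring
      _ ≤ 1 ^ j := by gcongr; exact (Real.abs_log_mul_self_lt v hv0 h1).le
      _ ≤ 9 ^ 9 := by norm_num
  · have h2 : v ^ t ≤ 9 ^ 6 := by
      calc v ^ t ≤ v ^ (6 : ℝ) := Real.rpow_le_rpow_of_exponent_le h1 ht6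
        _ = v ^ 6 := by norm_cast
        _ ≤ 9 ^ 6 := by gcongr
    have h3 : |Real.log v| ≤ 9 := by
      rw [abs_of_nonneg (Real.log_nonneg h1)]
      linarith [Real.log_le_self hv]
    calc v ^ t * |Real.log v| ^ j ≤ 9 ^ 6 * 9 ^ j := by gcongr
      _ ≤ 9 ^ 6 * 9 ^ 3 := by gcongr; norm_num
      _ = 9 ^ 9 := by norm_num

theorem hasDerivAt_integral_rpow_mul_log_pow {G : ℝ → ℝ} (hG : Continuous G) (h0 : ∀ x, 0 ≤ G x)
    (h9 : ∀ x, G x ≤ 9) {j : ℕ} (hj : j ≤ 2) {t : ℝ} (ht : t ∈ Set.Ioo (4 : ℝ) 6) :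
    HasDerivAt (fun t => ∫ x in (0:ℝ)..(1/2), G x ^ t * Real.log (G x) ^ j)
      (∫ x in (0:ℝ)..(1/2), G x ^ t * Real.log (G x) ^ (j + 1)) t := by
  have hmeas : ∀ (t : ℝ) (j : ℕ), Measurable fun x => G x ^ t * Real.log (G x) ^ j := by
    intro t j
    have := hG.measurable
    fun_prop
  refine (intervalIntegral.hasDerivAt_integral_of_dominated_loc_of_deriv_le
    (F := fun t x => G x ^ t * Real.log (G x) ^ j)
    (F' := fun t x => G x ^ t * Real.log (G x) ^ (j + 1)) (bound := fun _ => (9 : ℝ) ^ 9)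
    (Ioo_mem_nhds ht.1 ht.2) ?_ ?_ ?_ ?_ ?_ ?_).2
  · exact .of_forall fun t => (hmeas t j).aestronglyMeasurable
  · refine (intervalIntegrable_const (c := (9:ℝ) ^ 9)).mono_fun
      (hmeas t j).aestronglyMeasurable (.of_forall fun x => ?_)
    exact (abs_rpow_mul_log_pow_le (h0 x) (h9 x) ht.1.le ht.2.le (by omega)).trans (le_abs_self _)
  · exact (hmeas t (j + 1)).aestronglyMeasurable
  · refine .of_forall fun x _ t ht => ?_
    exact abs_rpow_mul_log_pow_le (h0 x) (h9 x) ht.1.le ht.2.le (by omega)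
  · exact intervalIntegrable_const
  · refine .of_forall fun x _ t ht => ?_
    have ht0 : 0 < t := by linarith [ht.1]
    rcases (h0 x).eq_or_lt with hx | hx
    · rw [← hx, Real.zero_rpow ht0.ne', zero_mul]
      refine (hasDerivAt_const t (0 : ℝ)).congr_of_eventuallyEq ?_
      filter_upwards [lt_mem_nhds ht0] with y hy
      rw [Real.zero_rpow hy.ne', zero_mul]
    · have := ((Real.hasStrictDerivAt_const_rpow hx t).hasDerivAt).mul_const (Real.log (G x) ^ j)
      exact this.congr_deriv (by rw [pow_succ]; ring)

theorem iteratedDeriv_three_of_hasDerivAt {f₀ f₁ f₂ f₃ : ℝ → ℝ} {s : Set ℝ} (hs : IsOpen s)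
    (h₀ : ∀ t ∈ s, HasDerivAt f₀ (f₁ t) t) (h₁ : ∀ t ∈ s, HasDerivAt f₁ (f₂ t) t)
    (h₂ : ∀ t ∈ s, HasDerivAt f₂ (f₃ t) t) {t : ℝ} (ht : t ∈ s) :
    iteratedDeriv 3 f₀ t = f₃ t := by
  have e₁ : ∀ t ∈ s, deriv f₀ t = f₁ t := fun t ht => (h₀ t ht).deriv
  have e₂ : ∀ t ∈ s, deriv (deriv f₀) t = f₂ t := fun t ht => by
    rw [Filter.EventuallyEq.deriv_eq (f := f₁) (Filter.eventually_of_mem (hs.mem_nhds ht) e₁)]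
    exact (h₁ t ht).deriv
  rw [iteratedDeriv_succ, iteratedDeriv_succ, iteratedDeriv_one]
  rw [Filter.EventuallyEq.deriv_eq (f := f₂) (Filter.eventually_of_mem (hs.mem_nhds ht) e₂)]
  exact (h₂ t ht).deriv

theorem continuous_pow_five_mul_log_cube : Continuous fun v : ℝ => v ^ 5 * Real.log v ^ 3 := by
  have h : (fun v : ℝ => v ^ 5 * Real.log v ^ 3) = fun v => v ^ 2 * (v * Real.log v) ^ 3 := by
    ext v; ring
  rw [h]
  exact (continuous_pow 2).mul (Real.continuous_mul_log.pow 3)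

theorem iteratedDeriv_three_d :
    iteratedDeriv 3 d 5 =
      (∫ x in (0:ℝ)..(1/2), Gm x ^ 5 * Real.log (Gm x) ^ 3) -
      (∫ x in (0:ℝ)..(1/2), Gp x ^ 5 * Real.log (Gp x) ^ 3) := by
  have hp : (1 : ℝ) ^ 2 = 1 := by norm_num
  have hm : (-1 : ℝ) ^ 2 = 1 := by norm_num
  let I : ℝ → ℕ → ℝ → ℝ := fun s j t =>
    ∫ x in (0:ℝ)..(1/2), trinomialSq s x ^ t * Real.log (trinomialSq s x) ^ j
  have hI : ∀ s : ℝ, s ^ 2 = 1 → ∀ j ≤ 2, ∀ t ∈ Set.Ioo (4:ℝ) 6,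
      HasDerivAt (I s j) (I s (j + 1) t) t := fun s hs j hj t ht =>
    hasDerivAt_integral_rpow_mul_log_pow (continuous_trinomialSq s) (trinomialSq_nonneg hs)
      (trinomialSq_le hs) hj ht
  have hD : ∀ j ≤ 2, ∀ t ∈ Set.Ioo (4:ℝ) 6,
      HasDerivAt (fun t => I (-1) j t - I 1 j t) (I (-1) (j + 1) t - I 1 (j + 1) t) t :=
    fun j hj t ht => (hI _ hm j hj t ht).sub (hI _ hp j hj t ht)
  have hd : ∀ t ∈ Set.Ioo (4:ℝ) 6, HasDerivAt d (I (-1) 1 t - I 1 1 t) t := by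
    intro t ht
    refine (hD 0 (by norm_num) t ht).congr_of_eventuallyEq ?_
    filter_upwards [lt_mem_nhds ht.1] with y hy
    have hint : ∀ s : ℝ, IntervalIntegrable (fun x => trinomialSq s x ^ y) volume 0 (1/2) :=
      fun s => ((continuous_trinomialSq s).rpow_const
        fun _ => Or.inr (by linarith)).intervalIntegrable _ _
    simp only [d, I, Gp_eq, Gm_eq, pow_zero, mul_one]
    exact intervalIntegral.integral_sub (hint _) (hint _)
  rw [iteratedDeriv_three_of_hasDerivAt isOpen_Ioo hd (hD 1 (by norm_num)) (hD 2 (by norm_num))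
    (t := 5) (by norm_num)]
  have h5 : ∀ v : ℝ, v ^ (5 : ℝ) = v ^ 5 := fun v => by norm_cast
  simp only [I, Gp_eq, Gm_eq, h5]

/-! ### Taylor approximation of `w ^ 5 * log w ^ j / j!` at `1` -/

/-- Taylor polynomial of degree `30` at `1`, in the variable `u = w - 1`. -/
noncomputable def logTaylor (j : ℕ) (u : ℝ) : ℝ :=
  ∑ k ∈ Finset.range 31, (fallCoeff j k : ℝ) / k.factorial * u ^ k

theorem one_add_mul_sum_deriv {a b : ℕ → ℝ} (h : ∀ k, (k + 1) * a (k + 1) = (5 - k) * a k + b k)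
    (u : ℝ) (n : ℕ) :
    (1 + u) * ∑ k ∈ Finset.range n, a k * (k * u ^ (k - 1)) =
      5 * ∑ k ∈ Finset.range n, a k * u ^ k + ∑ k ∈ Finset.range n, b k * u ^ k -
        n * a n * u ^ (n - 1) := by
  induction n with
  | zero => simp
  | succ n ih =>
    rw [Finset.sum_range_succ, Finset.sum_range_succ, Finset.sum_range_succ, mul_add, ih]
    push_cast
    rw [h n]
    rcases n with _ | n
    · simp
    · simp only [Nat.add_sub_cancel, pow_succ]; push_cast; ring

theorem fallCoeff_div_factorial_succ (j k : ℕ) :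
    ((k : ℝ) + 1) * ((fallCoeff (j + 1) (k + 1) : ℝ) / (k + 1).factorial) =
      (5 - k) * ((fallCoeff (j + 1) k : ℝ) / k.factorial) + (fallCoeff j k : ℝ) / k.factorial := by
  rw [fallCoeff, Nat.factorial_succ]
  have : (k.factorial : ℝ) ≠ 0 := by positivity
  have : (k : ℝ) + 1 ≠ 0 := by positivity
  push_cast
  field_simp

theorem hasDerivAt_logTaylor (j : ℕ) {u : ℝ} (hu : 0 < 1 + u) :
    HasDerivAt (logTaylor (j + 1))
      ((5 * logTaylor (j + 1) u + logTaylor j u -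
        (fallCoeff (j + 1) 31 : ℝ) / Nat.factorial 30 * u ^ 30) / (1 + u)) u := by
  have h := HasDerivAt.fun_sum (u := Finset.range 31) (fun k _ => (hasDerivAt_pow k u).const_mul
    ((fallCoeff (j + 1) k : ℝ) / k.factorial))
  refine h.congr_deriv ?_
  rw [eq_div_iff hu.ne', mul_comm,
    one_add_mul_sum_deriv (a := fun k => (fallCoeff (j + 1) k : ℝ) / k.factorial)
      (b := fun k => (fallCoeff j k : ℝ) / k.factorial) (fallCoeff_div_factorial_succ j)]
  have h31 : ((31 : ℕ).factorial : ℝ) = 31 * (30 : ℕ).factorial := by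
    rw [Nat.factorial_succ]; push_cast; ring
  have : ((30 : ℕ).factorial : ℝ) ≠ 0 := by positivity
  rw [h31]
  simp only [logTaylor]
  field_simp
  push_cast
  ring

/-- `w ^ 5 * log w ^ j / j!` minus its Taylor polynomial. -/
noncomputable def logRem (j : ℕ) (w : ℝ) : ℝ :=
  w ^ 5 * Real.log w ^ j / j.factorial - logTaylor j (w - 1)

theorem hasDerivAt_logRem (j : ℕ) {w : ℝ} (hw : 0 < w) :
    HasDerivAt (logRem (j + 1))
      ((5 * logRem (j + 1) w + logRem j w +
        (fallCoeff (j + 1) 31 : ℝ) / Nat.factorial 30 * (w - 1) ^ 30) / w) w := by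
  have h1 := ((hasDerivAt_pow 5 w).mul ((Real.hasDerivAt_log hw.ne').pow (j + 1))).div_const
    ((j + 1).factorial : ℝ)
  have h2 := (hasDerivAt_logTaylor j (u := w - 1) (by linarith)).comp_sub_const w 1
  refine (h1.sub h2).congr_deriv ?_
  simp only [logRem, Nat.factorial_succ, Pi.pow_apply, Nat.add_sub_cancel]
  have : (j.factorial : ℝ) ≠ 0 := by positivity
  have : (j : ℝ) + 1 ≠ 0 := by positivity
  have e : 1 + (w - 1) = w := by ring
  rw [e]
  push_cast
  field_simp
  ring

theorem logRem_succ_one (j : ℕ) : logRem (j + 1) 1 = 0 := by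
  simp [logRem, logTaylor, Finset.sum_range_succ', fallCoeff]

theorem logRem_zero (w : ℝ) : logRem 0 w = 0 := by
  simp [logRem, logTaylor, Finset.sum_range_succ, fallCoeff, Nat.factorial]
  ring

theorem le_of_hasDerivAt_of_le_one {R Q : ℝ → ℝ} {ρ η ε : ℝ}
    (hR : ∀ w, 0 < w → HasDerivAt R ((5 * R w + Q w + ρ * (w - 1) ^ 30) / w) w) (h1 : R 1 = 0)
    (hQ : ∀ w ∈ Set.Ioc (0 : ℝ) 1, |Q w| ≤ η) (hε : η + |ρ| ≤ 5 * ε) (hε0 : 0 ≤ ε) {w : ℝ}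
    (hw : w ∈ Set.Ioc (0 : ℝ) 1) : R w ≤ ε := by
  have hd : ∀ x, 0 < x → HasDerivAt (fun x => (R x - ε) / x ^ 5)
      ((Q x + ρ * (x - 1) ^ 30 + 5 * ε) / x ^ 6) x := fun x hx => by
    refine (((hR x hx).sub_const ε).fun_div (hasDerivAt_pow 5 x) (by positivity)).congr_deriv ?_
    field_simp
    push_cast
    ring
  have hmono : MonotoneOn (fun x => (R x - ε) / x ^ 5) (Set.Icc w 1) := by
    refine monotoneOn_of_hasDerivWithinAt_nonneg (convex_Icc w 1)
      (fun x hx => (hd x (hw.1.trans_le hx.1)).continuousAt.continuousWithinAt)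
      (fun x hx => (hd x ?_).hasDerivWithinAt) (fun x hx => ?_)
    · rw [interior_Icc] at hx
      exact hw.1.trans hx.1
    · rw [interior_Icc] at hx
      have hx0 : 0 < x := hw.1.trans hx.1
      have hq := abs_le.mp (hQ x ⟨hx0, hx.2.le⟩)
      have hp : |ρ * (x - 1) ^ 30| ≤ |ρ| := by
        rw [abs_mul, abs_pow]
        refine mul_le_of_le_one_right (abs_nonneg _) (pow_le_one₀ (abs_nonneg _) ?_)
        rw [abs_le]; constructor <;> linarith [hx.2]
      have := abs_le.mp hp
      refine div_nonneg ?_ (by positivity)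
      linarith [this.1]
  have := hmono (Set.left_mem_Icc.mpr hw.2) (Set.right_mem_Icc.mpr hw.2) hw.2
  simp only [h1] at this
  have hw5 : 0 < w ^ 5 := pow_pos hw.1 5
  rw [div_le_iff₀ hw5] at this
  nlinarith

theorem le_of_hasDerivAt_of_one_le {R Q : ℝ → ℝ} {ρ η ε : ℝ}
    (hR : ∀ w, 0 < w → HasDerivAt R ((5 * R w + Q w + ρ * (w - 1) ^ 30) / w) w) (h1 : R 1 = 0)
    (hQ : ∀ w ∈ Set.Icc (1 : ℝ) 2, |Q w| ≤ η * (w - 1) ^ 30) (hε : η + |ρ| ≤ 5 * ε) (hε0 : 0 ≤ ε)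
    {w : ℝ} (hw : w ∈ Set.Icc (1 : ℝ) 2) : R w ≤ ε * (w - 1) ^ 30 := by
  have hd : ∀ x, 0 < x → HasDerivAt (fun x => (R x - ε * (x - 1) ^ 30) / x ^ 5)
      ((Q x + ρ * (x - 1) ^ 30 + 5 * ε * (x - 1) ^ 30 - 30 * ε * (x - 1) ^ 29 * x) / x ^ 6) x :=
    fun x hx => by
    have h30 := (((hasDerivAt_id' x).sub_const 1).fun_pow 30).const_mul ε
    refine (((hR x hx).fun_sub h30).fun_div (hasDerivAt_pow 5 x) (by positivity)).congr_deriv ?_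
    field_simp
    push_cast
    ring
  have hanti : AntitoneOn (fun x => (R x - ε * (x - 1) ^ 30) / x ^ 5) (Set.Icc 1 w) := by
    refine antitoneOn_of_hasDerivWithinAt_nonpos (convex_Icc 1 w)
      (fun x hx => (hd x (one_pos.trans_le hx.1)).continuousAt.continuousWithinAt)
      (fun x hx => (hd x ?_).hasDerivWithinAt) (fun x hx => ?_)
    · rw [interior_Icc] at hx
      exact one_pos.trans hx.1
    · rw [interior_Icc] at hx
      have hx0 : 0 < x := one_pos.trans hx.1
      have hu : 0 ≤ x - 1 := by linarith [hx.1]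
      have hu1 : x - 1 ≤ 1 := by linarith [hx.2, hw.2]
      have hq := (abs_le.mp (hQ x ⟨hx.1.le, hx.2.le.trans hw.2⟩)).2
      have hu30 : 0 ≤ (x - 1) ^ 30 := by positivity
      have hp : ρ * (x - 1) ^ 30 ≤ |ρ| * (x - 1) ^ 30 := by gcongr; exact le_abs_self ρ
      have hc : (η + |ρ|) * (x - 1) ^ 30 ≤ 5 * ε * (x - 1) ^ 30 := by gcongr
      have h29 : ε * (x - 1) ^ 30 ≤ ε * (x - 1) ^ 29 * x := by
        rw [pow_succ, ← mul_assoc]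
        gcongr
        linarith
      have hn : 0 ≤ ε * (x - 1) ^ 30 := by positivity
      refine div_nonpos_of_nonpos_of_nonneg ?_ (by positivity)
      linarith
  have := hanti (Set.left_mem_Icc.mpr hw.1) (Set.right_mem_Icc.mpr hw.1) hw.1
  have hw5 : 0 < w ^ 5 := pow_pos (one_pos.trans_le hw.1) 5
  simp only [h1] at this
  rw [div_le_iff₀ hw5] at this
  norm_num at this
  linarith

theorem abs_logRem_succ_le {j : ℕ} {η ε : ℝ}
    (hl : ∀ w ∈ Set.Ioc (0 : ℝ) 1, |logRem j w| ≤ η)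
    (hr : ∀ w ∈ Set.Icc (1 : ℝ) 2, |logRem j w| ≤ η * (w - 1) ^ 30)
    (hε : η + |(fallCoeff (j + 1) 31 : ℝ) / Nat.factorial 30| ≤ 5 * ε) (hε0 : 0 ≤ ε) :
    (∀ w ∈ Set.Ioc (0 : ℝ) 1, |logRem (j + 1) w| ≤ ε) ∧
      ∀ w ∈ Set.Icc (1 : ℝ) 2, |logRem (j + 1) w| ≤ ε * (w - 1) ^ 30 := by
  have hd := fun w (hw : 0 < w) => hasDerivAt_logRem j hw
  have hd' : ∀ w, 0 < w → HasDerivAt (fun w => -logRem (j + 1) w)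
      ((5 * (-logRem (j + 1) w) + -logRem j w +
        -((fallCoeff (j + 1) 31 : ℝ) / Nat.factorial 30) * (w - 1) ^ 30) / w) w := fun w hw =>
    (hd w hw).fun_neg.congr_deriv (by ring)
  have h1 := logRem_succ_one j
  have h1' : -logRem (j + 1) 1 = 0 := by rw [h1, neg_zero]
  constructor <;> intro w hw <;> rw [abs_le']
  · exact ⟨le_of_hasDerivAt_of_le_one hd h1 hl hε hε0 hw,
      le_of_hasDerivAt_of_le_one hd' h1' (fun w hw => (abs_neg _).trans_le (hl w hw))
        (by rwa [abs_neg]) hε0 hw⟩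
  · exact ⟨le_of_hasDerivAt_of_one_le hd h1 hr hε hε0 hw,
      le_of_hasDerivAt_of_one_le hd' h1' (fun w hw => (abs_neg _).trans_le (hr w hw))
        (by rwa [abs_neg]) hε0 hw⟩

theorem abs_logRem_le {w : ℝ} (hw : w ∈ Set.Ioc (0 : ℝ) 2) :
    |logRem 1 w| ≤ 1404 / 10 ^ 9 ∧ |logRem 2 w| ≤ 2432 / 10 ^ 9 ∧
      |logRem 3 w| ≤ 992 / 10 ^ 9 := by
  have f1 : fallCoeff 1 31 = -1861345205199718318080000000 := by decide +kernel
  have f2 : fallCoeff 2 31 = 2852743905531454272307200000 := by decide +kernel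
  have f3 : fallCoeff 3 31 = 670452448854518553968640000 := by decide +kernel
  obtain ⟨l1, r1⟩ := abs_logRem_succ_le (j := 0) (η := 0) (ε := 1404 / 10 ^ 9)
    (by simp [logRem_zero]) (by simp [logRem_zero])
    (by rw [f1]; norm_num [abs_div, Nat.factorial]) (by norm_num)
  obtain ⟨l2, r2⟩ := abs_logRem_succ_le (ε := 2432 / 10 ^ 9) l1 r1
    (by rw [f2]; norm_num [abs_div, Nat.factorial]) (by norm_num)
  obtain ⟨l3, r3⟩ := abs_logRem_succ_le (ε := 992 / 10 ^ 9) l2 r2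
    (by rw [f3]; norm_num [abs_div, Nat.factorial]) (by norm_num)
  rcases le_total w 1 with h | h
  · exact ⟨l1 w ⟨hw.1, h⟩, l2 w ⟨hw.1, h⟩, l3 w ⟨hw.1, h⟩⟩
  · have hp : (w - 1) ^ 30 ≤ 1 := pow_le_one₀ (by linarith) (by linarith [hw.2])
    have hw' : w ∈ Set.Icc (1 : ℝ) 2 := ⟨h, hw.2⟩
    exact ⟨(r1 w hw').trans (mul_le_of_le_one_right (by norm_num) hp),
      (r2 w hw').trans (mul_le_of_le_one_right (by norm_num) hp),
      (r3 w hw').trans (mul_le_of_le_one_right (by norm_num) hp)⟩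

/-! ### Moments of `trinomialSq` -/

/-- The cosine sum `∑ i, l[i] * cos (2 * π * (m + i) * x)`. -/
noncomputable def cosSum : List ℤ → ℤ → ℝ → ℝ
  | [], _, _ => 0
  | a :: l, m, x => a * Real.cos (2 * Real.pi * m * x) + cosSum l (m + 1) x

theorem continuous_cosSum (l : List ℤ) (m : ℤ) : Continuous (cosSum l m) := by
  induction l generalizing m with
  | nil => exact continuous_const
  | cons a l ih =>
    have := ih (m + 1)
    change Continuous fun x => a * Real.cos (2 * Real.pi * m * x) + cosSum l (m + 1) x
    fun_prop

theorem cosSum_coeffAdd (l l' : List ℤ) (m : ℤ) (x : ℝ) :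
    cosSum (coeffAdd l l') m x = cosSum l m x + cosSum l' m x := by
  induction l generalizing l' m with
  | nil => simp [coeffAdd, cosSum]
  | cons a l ih =>
    cases l' with
    | nil => simp [coeffAdd, cosSum]
    | cons b l' => simp only [coeffAdd, cosSum, ih]; push_cast; ring

theorem cosSum_map_mul (a : ℤ) (l : List ℤ) (m : ℤ) (x : ℝ) :
    cosSum (l.map (a * ·)) m x = a * cosSum l m x := by
  induction l generalizing m with
  | nil => simp [cosSum]
  | cons b l ih => simp only [List.map_cons, cosSum, ih]; push_cast; ring

theorem cosSum_coeffMul_cons (a : ℤ) (p l : List ℤ) (m : ℤ) (x : ℝ) :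
    cosSum (coeffMul (a :: p) l) m x = a * cosSum l m x + cosSum (coeffMul p l) (m + 1) x := by
  simp [coeffMul, cosSum_coeffAdd, cosSum_map_mul, cosSum]

theorem two_cos_mul_cosSum (l : List ℤ) (m j : ℤ) (x : ℝ) :
    2 * Real.cos (2 * Real.pi * j * x) * cosSum l m x = cosSum l (m + j) x + cosSum l (m - j) x := by
  induction l generalizing m with
  | nil => simp [cosSum]
  | cons a l ih =>
    have h1 := Real.cos_add (2 * Real.pi * m * x) (2 * Real.pi * j * x)
    have h2 := Real.cos_sub (2 * Real.pi * m * x) (2 * Real.pi * j * x)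
    have h3 := ih (m + 1)
    have e1 : 2 * Real.pi * ((m + j : ℤ) : ℝ) * x =
        2 * Real.pi * m * x + 2 * Real.pi * j * x := by push_cast; ring
    have e2 : 2 * Real.pi * ((m - j : ℤ) : ℝ) * x =
        2 * Real.pi * m * x - 2 * Real.pi * j * x := by push_cast; ring
    rw [add_right_comm, add_sub_right_comm] at h3
    simp only [cosSum, e1, e2, h1, h2]
    linear_combination h3

theorem two_mul_trinomialSq_sub_nine_pow (s : ℤ) (k : ℕ) (x : ℝ) :
    (2 * trinomialSq s x - 9) ^ k = cosSum (basePow s k) (-(7 * k)) x := by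
  induction k with
  | zero => simp [basePow, cosSum]
  | succ k ih =>
    have h1 := two_cos_mul_cosSum (basePow s k) (-(7 * k)) 1 x
    have h6 := two_cos_mul_cosSum (basePow s k) (-(7 * k)) 6 x
    have h7 := two_cos_mul_cosSum (basePow s k) (-(7 * k)) 7 x
    have e1 : 2 * Real.pi * ((1 : ℤ) : ℝ) * x = 2 * Real.pi * x := by push_cast; ring
    have e6 : 2 * Real.pi * ((6 : ℤ) : ℝ) * x = 12 * Real.pi * x := by push_cast; ring
    have e7 : 2 * Real.pi * ((7 : ℤ) : ℝ) * x = 14 * Real.pi * x := by push_cast; ring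
    rw [e1] at h1
    rw [e6] at h6
    rw [e7] at h7
    have hm : (-(7 * ((k + 1 : ℕ) : ℤ))) = -(7 * k) - 7 := by push_cast; ring
    have hnil : ∀ l m, cosSum (coeffMul [] l) m x = 0 := fun _ _ => rfl
    rw [pow_succ, ih, hm, basePow, base]
    simp only [cosSum_coeffMul_cons, hnil]
    generalize (-(7 * (k : ℤ))) = m at *
    rw [show m - 7 + 1 = m - 6 by ring, show m - 6 + 1 + 1 + 1 + 1 + 1 = m - 1 by ring,
      show m - 1 + 1 = m by ring, show m + 1 + 1 + 1 + 1 + 1 + 1 = m + 6 by ring,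
      show m + 6 + 1 = m + 7 by ring]
    rw [trinomialSq]
    push_cast
    linear_combination 2 * h1 + 2 * s * h6 + 2 * s * h7

theorem integral_cos_two_pi_int_mul (m : ℤ) :
    ∫ x in (0:ℝ)..(1/2), Real.cos (2 * Real.pi * m * x) = if m = 0 then 1 / 2 else 0 := by
  split_ifs with h
  · simp [h]
  · have hm : (2 * Real.pi * m : ℝ) ≠ 0 := by
      have : (m : ℝ) ≠ 0 := by exact_mod_cast h
      positivity
    rw [intervalIntegral.integral_comp_mul_left (fun y => Real.cos y) hm, integral_cos]
    rw [show 2 * Real.pi * m * (1 / 2) = m * Real.pi by ring, Real.sin_int_mul_pi]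
    simp

theorem integral_cosSum (l : List ℤ) (m : ℤ) :
    ∫ x in (0:ℝ)..(1/2), cosSum l m x =
      if m ≤ 0 then (l.getD (-m).toNat 0 : ℝ) / 2 else 0 := by
  induction l generalizing m with
  | nil => simp [cosSum]
  | cons a l ih =>
    simp only [cosSum]
    rw [intervalIntegral.integral_add
      (Continuous.intervalIntegrable (by fun_prop) _ _)
      ((continuous_cosSum l (m + 1)).intervalIntegrable _ _),
      intervalIntegral.integral_const_mul, integral_cos_two_pi_int_mul, ih]
    rcases lt_trichotomy m 0 with h | rfl | h
    · rw [if_neg h.ne, if_pos (by omega), if_pos h.le,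
        show (-m).toNat = (-(m + 1)).toNat + 1 by omega]
      simp
    · simp; ring
    · rw [if_neg h.ne', if_neg (by omega), if_neg (by omega)]
      simp

theorem integral_trinomialSq_pow (s : ℤ) (k : ℕ) :
    ∫ x in (0:ℝ)..(1/2), (2 / 9 * trinomialSq s x - 1) ^ k = moment s k / (2 * 9 ^ k) := by
  have h : ∀ x, (2 / 9 * trinomialSq s x - 1) ^ k =
      1 / 9 ^ k * cosSum (basePow s k) (-(7 * k)) x := fun x => by
    rw [← two_mul_trinomialSq_sub_nine_pow, ← one_div_pow, ← mul_pow]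
    ring
  simp only [h]
  rw [intervalIntegral.integral_const_mul, integral_cosSum, if_pos (by omega), neg_neg, moment,
    show (7 * (k : ℤ)).toNat = 7 * k by omega]
  field_simp

theorem integral_logTaylor (s : ℤ) (j : ℕ) :
    ∫ x in (0:ℝ)..(1/2), logTaylor j (2 / 9 * trinomialSq s x - 1) =
      ∑ k ∈ Finset.range 31, (fallCoeff j k : ℝ) / k.factorial * (moment s k / (2 * 9 ^ k)) := by
  have := continuous_trinomialSq s
  simp only [logTaylor]
  rw [intervalIntegral.integral_finsetSum
    fun k _ => Continuous.intervalIntegrable (by fun_prop) _ _]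
  refine Finset.sum_congr rfl fun k _ => ?_
  rw [intervalIntegral.integral_const_mul, integral_trinomialSq_pow]

/-- `∫ (logTaylor j (2 / 9 * Gm - 1) - logTaylor j (2 / 9 * Gp - 1))`. -/
noncomputable def taylorGap (j : ℕ) : ℝ :=
  ∑ k ∈ Finset.range 31, (fallCoeff j k : ℝ) / k.factorial *
    (((moment (-1) k - moment 1 k : ℤ) : ℝ) / (2 * 9 ^ k))

theorem integral_logTaylor_sub (j : ℕ) :
    (∫ x in (0:ℝ)..(1/2), logTaylor j (2 / 9 * Gm x - 1)) -
      (∫ x in (0:ℝ)..(1/2), logTaylor j (2 / 9 * Gp x - 1)) = taylorGap j := by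
  have hm := integral_logTaylor (-1) j
  have hp := integral_logTaylor 1 j
  rw [Int.cast_neg, Int.cast_one] at hm
  rw [Int.cast_one] at hp
  rw [Gm_eq, Gp_eq, hm, hp, ← Finset.sum_sub_distrib, taylorGap]
  refine Finset.sum_congr rfl fun k _ => ?_
  push_cast
  ring

theorem eq_getD_of_map_range_eq {f : ℕ → ℤ} {n : ℕ} {l : List ℤ} (h : (List.range n).map f = l)
    {k : ℕ} (hk : k ∈ Finset.range n) : f k = l.getD k 0 := by
  rw [← h]
  simp [List.getD_eq_getElem?_getD, Finset.mem_range.mp hk]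

theorem taylorGap_eq {j : ℕ} {l : List ℤ} (h : (List.range 31).map (fallCoeff j) = l) :
    taylorGap j = ∑ k ∈ Finset.range 31, (l.getD k 0 : ℝ) / k.factorial *
      ((momentDiffs.getD k 0 : ℝ) / (2 * 9 ^ k)) := by
  refine Finset.sum_congr rfl fun k hk => ?_
  rw [eq_getD_of_map_range_eq h hk, eq_getD_of_map_range_eq map_moment_sub hk]

theorem taylorGap_zero : taylorGap 0 = 0 := by
  rw [taylorGap_eq fallCoeff_zero_values]
  simp [Finset.sum_range_succ, momentDiffs]

theorem taylorGap_one : 155 / 10 ^ 8 ≤ taylorGap 1 := by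
  rw [taylorGap_eq fallCoeff_one_values]
  simp only [Finset.sum_range_succ, momentDiffs, List.getD_cons_succ, List.getD_cons_zero,
    Finset.sum_range_zero, Nat.factorial]
  norm_num

theorem taylorGap_two : 68 / 10 ^ 7 ≤ taylorGap 2 := by
  rw [taylorGap_eq fallCoeff_two_values]
  simp only [Finset.sum_range_succ, momentDiffs, List.getD_cons_succ, List.getD_cons_zero,
    Finset.sum_range_zero, Nat.factorial]
  norm_num

theorem taylorGap_three : 455 / 10 ^ 8 ≤ taylorGap 3 := by
  rw [taylorGap_eq fallCoeff_three_values]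
  simp only [Finset.sum_range_succ, momentDiffs, List.getD_cons_succ, List.getD_cons_zero,
    Finset.sum_range_zero, Nat.factorial]
  norm_num

/-! ### Positivity -/

theorem log_nine_halves_mem_Ioo : Real.log (9 / 2) ∈ Set.Ioo (1.504 : ℝ) 1.505 := by
  have h : Real.log (9 / 2) = 2 * Real.log 3 - Real.log 2 := by
    rw [Real.log_div (by norm_num) (by norm_num), show (9 : ℝ) = 3 ^ 2 by norm_num, Real.log_pow]
    norm_num
  rw [h]
  constructor <;> linarith [Real.log_three_gt_d9, Real.log_three_lt_d9, Real.log_two_gt_d9,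
    Real.log_two_lt_d9]

/-- The polynomial approximation of `v ^ 5 * log v ^ 3` on `[0, 9]`. -/
noncomputable def approxPoly (v : ℝ) : ℝ :=
  (9 / 2) ^ 5 * (Real.log (9 / 2) ^ 3 * logTaylor 0 (2 / 9 * v - 1) +
    3 * Real.log (9 / 2) ^ 2 * logTaylor 1 (2 / 9 * v - 1) +
    6 * Real.log (9 / 2) * logTaylor 2 (2 / 9 * v - 1) + 6 * logTaylor 3 (2 / 9 * v - 1))

theorem continuous_logTaylor (j : ℕ) : Continuous (logTaylor j) := by
  unfold logTaylor; fun_prop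

theorem continuous_approxPoly : Continuous approxPoly := by
  have := continuous_logTaylor
  unfold approxPoly; fun_prop

theorem abs_sub_approxPoly_le {v : ℝ} (hv : v ∈ Set.Icc (0 : ℝ) 9) :
    |v ^ 5 * Real.log v ^ 3 - approxPoly v| ≤ 0.07 := by
  have hclosed : IsClosed {v : ℝ | |v ^ 5 * Real.log v ^ 3 - approxPoly v| ≤ 0.07} :=
    isClosed_le (continuous_pow_five_mul_log_cube.sub continuous_approxPoly).abs continuous_const
  rw [← closure_Ioc (by norm_num : (0 : ℝ) ≠ 9)] at hv
  refine hclosed.closure_subset_iff.mpr (fun v hv => ?_) hv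
  obtain ⟨w, rfl⟩ : ∃ w, v = 9 / 2 * w := ⟨2 / 9 * v, by ring⟩
  have hw : w ∈ Set.Ioc (0 : ℝ) 2 := ⟨by linarith [hv.1], by linarith [hv.2]⟩
  obtain ⟨h1, h2, h3⟩ := abs_logRem_le hw
  have h0 := logRem_zero w
  obtain ⟨hL, hL'⟩ := log_nine_halves_mem_Ioo
  rw [Set.mem_ofPred_eq, approxPoly, Real.log_mul (by norm_num) hw.1.ne',
    show 2 / 9 * (9 / 2 * w) - 1 = w - 1 by ring]
  generalize Real.log (9 / 2) = L at *
  have e : (9 / 2 * w) ^ 5 * (L + Real.log w) ^ 3 - (9 / 2) ^ 5 * (L ^ 3 * logTaylor 0 (w - 1) +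
      3 * L ^ 2 * logTaylor 1 (w - 1) + 6 * L * logTaylor 2 (w - 1) + 6 * logTaylor 3 (w - 1)) =
      (9 / 2) ^ 5 * (3 * L ^ 2 * logRem 1 w + 6 * L * logRem 2 w + 6 * logRem 3 w) := by
    have h0' : (9 / 2) ^ 5 * L ^ 3 * logRem 0 w = 0 := by rw [h0, mul_zero]
    simp only [logRem, Nat.factorial] at h0' ⊢
    push_cast at h0' ⊢
    linear_combination h0'
  rw [e, abs_mul, abs_of_pos (by norm_num : (0 : ℝ) < (9 / 2) ^ 5)]
  have hL0 : 0 ≤ L := by linarith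
  calc (9 / 2) ^ 5 * |3 * L ^ 2 * logRem 1 w + 6 * L * logRem 2 w + 6 * logRem 3 w|
      ≤ (9 / 2) ^ 5 * (|3 * L ^ 2 * logRem 1 w| + |6 * L * logRem 2 w| + |6 * logRem 3 w|) := by
        gcongr; exact abs_add_three _ _ _
    _ = (9 / 2) ^ 5 * (3 * L ^ 2 * |logRem 1 w| + 6 * L * |logRem 2 w| + 6 * |logRem 3 w|) := by
        simp only [abs_mul, abs_pow, abs_of_nonneg hL0, Nat.abs_ofNat]
    _ ≤ (9 / 2) ^ 5 * (3 * 1.505 ^ 2 * (1404 / 10 ^ 9) + 6 * 1.505 * (2432 / 10 ^ 9) +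
          6 * (992 / 10 ^ 9)) := by gcongr
    _ ≤ 0.07 := by norm_num

theorem abs_integral_sub_integral_approxPoly_le {G : ℝ → ℝ} (hG : Continuous G)
    (h : ∀ x, G x ∈ Set.Icc (0 : ℝ) 9) :
    |(∫ x in (0:ℝ)..(1/2), G x ^ 5 * Real.log (G x) ^ 3) -
      ∫ x in (0:ℝ)..(1/2), approxPoly (G x)| ≤ 0.035 := by
  have hf : Continuous fun x => G x ^ 5 * Real.log (G x) ^ 3 :=
    continuous_pow_five_mul_log_cube.comp hG
  have hq : Continuous fun x => approxPoly (G x) := continuous_approxPoly.comp hG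
  rw [← intervalIntegral.integral_sub (hf.intervalIntegrable _ _) (hq.intervalIntegrable _ _)]
  have hb := intervalIntegral.norm_integral_le_of_norm_le_const (a := 0) (b := 1 / 2) (C := 0.07)
    (f := fun x => G x ^ 5 * Real.log (G x) ^ 3 - approxPoly (G x))
    fun x _ => abs_sub_approxPoly_le (h x)
  rw [Real.norm_eq_abs] at hb
  exact hb.trans (by norm_num [abs_of_pos])

theorem integral_approxPoly {G : ℝ → ℝ} (hG : Continuous G) :
    ∫ x in (0:ℝ)..(1/2), approxPoly (G x) =
      (9 / 2) ^ 5 * (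
        Real.log (9 / 2) ^ 3 * (∫ x in (0:ℝ)..(1/2), logTaylor 0 (2 / 9 * G x - 1)) +
        3 * Real.log (9 / 2) ^ 2 * (∫ x in (0:ℝ)..(1/2), logTaylor 1 (2 / 9 * G x - 1)) +
        6 * Real.log (9 / 2) * (∫ x in (0:ℝ)..(1/2), logTaylor 2 (2 / 9 * G x - 1)) +
        6 * ∫ x in (0:ℝ)..(1/2), logTaylor 3 (2 / 9 * G x - 1)) := by
  have hT := continuous_logTaylor
  have hi : ∀ (c : ℝ) (j : ℕ), IntervalIntegrable
      (fun x => c * logTaylor j (2 / 9 * G x - 1)) volume 0 (1/2) := fun c j =>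
    Continuous.intervalIntegrable (by fun_prop) _ _
  simp only [approxPoly]
  rw [intervalIntegral.integral_const_mul,
    intervalIntegral.integral_add (((hi _ _).add (hi _ _)).add (hi _ _)) (hi _ _),
    intervalIntegral.integral_add ((hi _ _).add (hi _ _)) (hi _ _),
    intervalIntegral.integral_add (hi _ _) (hi _ _)]
  simp only [intervalIntegral.integral_const_mul]

theorem integral_approxPoly_sub_lower :
    0.18 ≤ (∫ x in (0:ℝ)..(1/2), approxPoly (Gm x)) - ∫ x in (0:ℝ)..(1/2), approxPoly (Gp x) := by
  have hm := integral_approxPoly (G := Gm) (Gm_eq ▸ continuous_trinomialSq _)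
  have hp := integral_approxPoly (G := Gp) (Gp_eq ▸ continuous_trinomialSq _)
  have e0 := integral_logTaylor_sub 0
  have e1 := integral_logTaylor_sub 1
  have e2 := integral_logTaylor_sub 2
  have e3 := integral_logTaylor_sub 3
  rw [taylorGap_zero] at e0
  obtain ⟨hL, -⟩ := log_nine_halves_mem_Ioo
  generalize Real.log (9 / 2) = L at *
  have e : (∫ x in (0:ℝ)..(1/2), approxPoly (Gm x)) - ∫ x in (0:ℝ)..(1/2), approxPoly (Gp x) =
      (9 / 2) ^ 5 * (3 * L ^ 2 * taylorGap 1 + 6 * L * taylorGap 2 + 6 * taylorGap 3) := by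
    rw [hm, hp]
    linear_combination (9 / 2) ^ 5 * (L ^ 3 * e0 + 3 * L ^ 2 * e1 + 6 * L * e2 + 6 * e3)
  rw [e]
  calc (0.18 : ℝ) ≤ (9 / 2) ^ 5 * (3 * 1.504 ^ 2 * (155 / 10 ^ 8) + 6 * 1.504 * (68 / 10 ^ 7) +
        6 * (455 / 10 ^ 8)) := by norm_num
    _ ≤ _ := by
        gcongr
        exacts [taylorGap_one, taylorGap_two, taylorGap_three]

theorem stmt11 :
    iteratedDeriv 3 d 5 =
      (∫ x in (0:ℝ)..(1/2), Gm x ^ 5 * Real.log (Gm x) ^ 3) -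
      (∫ x in (0:ℝ)..(1/2), Gp x ^ 5 * Real.log (Gp x) ^ 3) ∧
    0 < iteratedDeriv 3 d 5 := by
  refine ⟨iteratedDeriv_three_d, ?_⟩
  rw [iteratedDeriv_three_d]
  have hm := abs_integral_sub_integral_approxPoly_le (G := Gm)
    (Gm_eq ▸ continuous_trinomialSq _) fun x => by
      rw [Gm_eq]; exact ⟨trinomialSq_nonneg (by norm_num) x, trinomialSq_le (by norm_num) x⟩
  have hp := abs_integral_sub_integral_approxPoly_le (G := Gp)
    (Gp_eq ▸ continuous_trinomialSq _) fun x => by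
      rw [Gp_eq]; exact ⟨trinomialSq_nonneg (by norm_num) x, trinomialSq_le (by norm_num) x⟩
  have hQ := integral_approxPoly_sub_lower
  linarith [(abs_le.mp hm).1, (abs_le.mp hp).2]
end
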